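/- arXiv:1902.07183 — 3 statements merged into one kernel-verified Lean document; each statement's English description precedes it below -/
import Mathlib

section
/- Let L be a free ℤ-module of finite rank r and let K_1,…,K_s ⊆ L be saturated submodules (i.e. each L/K_i is torsion-free), with d_i := rank L − rank K_i. For each i let α_i be a generator of the rank-one ℤ-module Λ^{d_i}(Ann K_i). Set K := K_1 ∩ ⋯ ∩ K_s and d := d_1 + ⋯ + d_s. Then: (a) if rank L − rank K < d, then α_1∧⋯∧α_s = 0 in Λ^d Hom(L,ℤ); (b) if rank L − rank K = d, then α_1∧⋯∧α_s = ±w·α, where α is a generator of the rank-one ℤ-module Λ^d(Ann K) and w is the index (cardinality of the cokernel) of the natural injection L/K → ⊕_{i=1}^s L/K_i, which in this case is an injection of free ℤ-modules of equal rank and hence has finite cokernel. -/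
set_option synthInstance.maxHeartbeats 1000000
set_option maxHeartbeats 1000000

open Module

/-- The image of the `d`-th exterior power `Λ^d W` of a submodule `W ⊆ V` inside the
exterior algebra of `V`, i.e. the span of `d`-fold products of elements of `W`. -/
noncomputable def extSubPow {V : Type} [AddCommGroup V] (W : Submodule ℤ V) (d : ℕ) :
    Submodule ℤ (ExteriorAlgebra ℤ V) :=
  (Submodule.map (ExteriorAlgebra.ι ℤ) W) ^ d

/-- Concatenating the blocks of a family indexed by a sigma type does not change its product. -/
theorem prod_ofFn_finSigmaFinEquiv {A : Type*} [Monoid A] {s : ℕ} (d : Fin s → ℕ)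
    (g : (Σ i, Fin (d i)) → A) :
    (List.ofFn fun k => g (finSigmaFinEquiv.symm k)).prod =
      (List.ofFn fun i => (List.ofFn fun j => g ⟨i, j⟩).prod).prod := by
  induction s with
  | zero =>
    rw [List.ofFn_congr (show ∑ i : Fin 0, d i = 0 by simp)]
    simp
  | succ s ih =>
    rw [List.ofFn_succ', List.concat_eq_append, List.prod_append, List.prod_singleton,
      ← ih (fun i => d i.castSucc) (fun p => g ⟨p.1.castSucc, p.2⟩),
      List.ofFn_congr (Fin.sum_univ_castSucc d), List.ofFn_add, List.prod_append]
    congr 3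
    · funext k
      obtain ⟨p, rfl⟩ := finSigmaFinEquiv.surjective k
      rw [Equiv.symm_apply_apply]
      congr 1
      rw [Equiv.symm_apply_eq]
      ext
      simp [finSigmaFinEquiv_apply]
    · funext k
      congr 1
      rw [Equiv.symm_apply_eq]
      ext
      simp [finSigmaFinEquiv_apply]
      rfl

theorem prod_ofFn_eq_or_eq_neg {A : Type*} [Ring A] {s : ℕ} (a b : Fin s → A)
    (h : ∀ i, a i = b i ∨ a i = -b i) :
    (List.ofFn a).prod = (List.ofFn b).prod ∨ (List.ofFn a).prod = -(List.ofFn b).prod := by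
  induction s with
  | zero => simp
  | succ s ih =>
    simp only [List.ofFn_succ, List.prod_cons]
    rcases h 0 with h0 | h0 <;>
      rcases ih (fun i => a i.succ) (fun i => b i.succ) (fun i => h i.succ) with h1 | h1 <;>
      simp [h0, h1]

theorem ExteriorAlgebra.ιMulti_eq_det_smul {R M : Type*} [CommRing R] [AddCommGroup M] [Module R M]
    {n : ℕ} (e : Basis (Fin n) R M) (v : Fin n → M) :
    ExteriorAlgebra.ιMulti R n v = e.det v • ExteriorAlgebra.ιMulti R n e := by
  have h : ExteriorAlgebra.ιMulti R n (M := M) =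
      (LinearMap.toSpanSingleton R _ (ExteriorAlgebra.ιMulti R n e)).compAlternatingMap e.det := by
    refine e.ext_alternating fun σ hσ => ?_
    have hb : Function.Bijective σ := Finite.injective_iff_bijective.mp hσ
    have h1 := (ExteriorAlgebra.ιMulti R n (M := M)).map_perm e (Equiv.ofBijective σ hb)
    have h2 := e.det.map_perm e (Equiv.ofBijective σ hb)
    simp only [Function.comp_def, Equiv.ofBijective_apply] at h1 h2
    simp [h1, h2, Basis.det_self]
  rw [h]
  simp [Basis.det_self]

theorem extSubPow_range {M V : Type} [AddCommGroup M] [AddCommGroup V] (g : M →ₗ[ℤ] V)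
    {n : ℕ} (e : Basis (Fin n) ℤ M) :
    extSubPow (LinearMap.range g) n =
      Submodule.span ℤ {ExteriorAlgebra.ιMulti ℤ n (fun i => g (e i))} := by
  have h : ⋀[ℤ]^n M = Submodule.span ℤ {ExteriorAlgebra.ιMulti ℤ n e} := by
    rw [← ExteriorAlgebra.ιMulti_span_fixedDegree]
    apply le_antisymm
    · rw [Submodule.span_le]
      rintro _ ⟨v, rfl⟩
      rw [ExteriorAlgebra.ιMulti_eq_det_smul e v]
      exact Submodule.smul_mem _ _ (Submodule.mem_span_singleton_self _)
    · exact Submodule.span_mono (by rintro _ rfl; exact ⟨_, rfl⟩)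
  have h2 : Submodule.map (ExteriorAlgebra.ι ℤ) (LinearMap.range g) =
      Submodule.map (ExteriorAlgebra.map g).toLinearMap (LinearMap.range (ExteriorAlgebra.ι ℤ)) := by
    rw [← LinearMap.range_comp, ← LinearMap.range_comp, ExteriorAlgebra.map_comp_ι]
  rw [extSubPow, h2, ← Submodule.map_pow]
  change Submodule.map _ (⋀[ℤ]^n M) = _
  rw [h, Submodule.map_span, Set.image_singleton, AlgHom.toLinearMap_apply,
    ExteriorAlgebra.map_apply_ιMulti]
  rfl

theorem extSubPow_dualAnnihilator {L : Type} [AddCommGroup L] (K : Submodule ℤ L)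
    {n : ℕ} (b : Basis (Fin n) ℤ (L ⧸ K)) :
    extSubPow K.dualAnnihilator n =
      Submodule.span ℤ {ExteriorAlgebra.ιMulti ℤ n (fun i => (b.coord i).comp K.mkQ)} := by
  rw [← K.range_dualMap_mkQ_eq, extSubPow_range _ b.dualBasis]
  simp only [Basis.coe_dualBasis]
  rfl

/-- Two generators of the line spanned by a decomposable element agree up to sign. -/
theorem eq_or_eq_neg_of_span_singleton_eq_span_ιMulti {V : Type*} [AddCommGroup V]
    [Module.Free ℤ V] {n : ℕ} (v : Fin n → V) (a : ExteriorAlgebra ℤ V)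
    (h : Submodule.span ℤ {a} = Submodule.span ℤ {ExteriorAlgebra.ιMulti ℤ n v}) :
    a = ExteriorAlgebra.ιMulti ℤ n v ∨ a = -ExteriorAlgebra.ιMulti ℤ n v := by
  have ha : a ∈ ⋀[ℤ]^n V := by
    have : a ∈ Submodule.span ℤ {ExteriorAlgebra.ιMulti ℤ n v} :=
      h ▸ Submodule.mem_span_singleton_self a
    obtain ⟨c, rfl⟩ := Submodule.mem_span_singleton.mp this
    exact Submodule.smul_mem _ _ (ExteriorAlgebra.ιMulti_range ℤ n ⟨v, rfl⟩)
  have h' : Submodule.span ℤ {(⟨a, ha⟩ : ⋀[ℤ]^n V)} =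
      Submodule.span ℤ {exteriorPower.ιMulti ℤ n v} := by
    apply Submodule.map_injective_of_injective (Submodule.subtype_injective (⋀[ℤ]^n V))
    simpa [Submodule.map_span] using h
  obtain ⟨u, hu⟩ := Submodule.span_singleton_eq_span_singleton.mp h'
  have hu' : (u : ℤ) • a = ExteriorAlgebra.ιMulti ℤ n v := congrArg Subtype.val hu
  rcases Int.units_eq_one_or u with rfl | rfl
  · left; simpa using hu'
  · right; rw [← hu']; simp

/-- The index of the image of an injective map between free `ℤ`-modules of equal rank. -/
theorem natAbs_det_eq_card_quotient_range {ι M N : Type*} [Fintype ι] [DecidableEq ι]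
    [AddCommGroup M] [AddCommGroup N] (bM : Basis ι ℤ M) (bN : Basis ι ℤ N) (f : M →ₗ[ℤ] N)
    (hf : Function.Injective f) :
    (bM.dualBasis.det fun i => (bN.coord i).comp f).natAbs =
      Nat.card (N ⧸ LinearMap.range f) := by
  have := Module.Free.of_basis bN
  have := Module.Finite.of_basis bN
  rw [← Submodule.natAbs_det_basis_change bN _ (bM.map (LinearEquiv.ofInjective f hf)),
    Basis.det_apply, Basis.det_apply, ← Matrix.det_transpose]
  congr 2
  ext i j
  simp [Basis.toMatrix_apply]

/-- **Tropical intersections and wedge products** (Lemma `Trop-Wedge`).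
Let `L` be a free `ℤ`-module of finite rank and `K 0, …, K (s-1) ⊆ L` saturated submodules
(each `L ⧸ K i` is torsion-free), with `d i = rank L − rank (K i)`, and let `α i` be a
generator of the rank-one module `Λ^{d i}(Ann (K i))`.  Put `K := ⋂ K i` and `d := ∑ d i`.
(a) If `rank L − rank K < d` then `α 0 ∧ ⋯ ∧ α (s-1) = 0`.
(b) If `rank L − rank K = d` then `α 0 ∧ ⋯ ∧ α (s-1) = ± w • α` for a generator `α` of
`Λ^d (Ann K)`, where `w` is the index (cardinality of the cokernel) of the natural injection
`L ⧸ K → ⊕ᵢ L ⧸ K i` (equivalently, of the map `L → ⊕ᵢ L ⧸ K i`, which has the same image). -/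
theorem trop_wedge (L : Type) [AddCommGroup L] [Module.Free ℤ L] [Module.Finite ℤ L]
    (s : ℕ) (K : Fin s → Submodule ℤ L)
    (hsat : ∀ i, NoZeroSMulDivisors ℤ (L ⧸ K i))
    (d : Fin s → ℕ) (hd : ∀ i, d i = finrank ℤ L - finrank ℤ (K i))
    (α : Fin s → ExteriorAlgebra ℤ (Module.Dual ℤ L))
    (hα : ∀ i, Submodule.span ℤ {α i} = extSubPow ((K i).dualAnnihilator) (d i)) :
    (finrank ℤ L - finrank ℤ (⨅ i, K i : Submodule ℤ L) < ∑ i, d i →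
      (List.ofFn α).prod = 0) ∧
    (finrank ℤ L - finrank ℤ (⨅ i, K i : Submodule ℤ L) = ∑ i, d i →
      ∃ β : ExteriorAlgebra ℤ (Module.Dual ℤ L),
        Submodule.span ℤ {β} = extSubPow ((⨅ i, K i : Submodule ℤ L).dualAnnihilator) (∑ i, d i) ∧
        ((List.ofFn α).prod =
            (Nat.card ((∀ i, L ⧸ K i) ⧸
              LinearMap.range (LinearMap.pi fun i => (K i).mkQ)) : ℤ) • β ∨
         (List.ofFn α).prod =
            -((Nat.card ((∀ i, L ⧸ K i) ⧸
              LinearMap.range (LinearMap.pi fun i => (K i).mkQ)) : ℤ) • β))) := by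
  have hfin : ∀ P : Submodule ℤ L, finrank ℤ L - finrank ℤ P = finrank ℤ (L ⧸ P) := fun P => by
    rw [← P.finrank_quotient_add_finrank, Nat.add_sub_cancel]
  let b : ∀ i, Basis (Fin (d i)) ℤ (L ⧸ K i) := fun i =>
    finBasisOfFinrankEq ℤ _ ((hfin (K i)).symm.trans (hd i).symm)
  let B : Basis (Fin (∑ i, d i)) ℤ (∀ i, L ⧸ K i) := (Pi.basis b).reindex finSigmaFinEquiv
  let P : Submodule ℤ L := ⨅ i, K i
  let φ : L →ₗ[ℤ] (∀ i, L ⧸ K i) := LinearMap.pi fun i => (K i).mkQ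
  have hker : LinearMap.ker φ = P := by
    simp [φ, P, LinearMap.ker_pi]
  let f : (L ⧸ P) →ₗ[ℤ] (∀ i, L ⧸ K i) := P.liftQ φ hker.ge
  have hf : Function.Injective f := by
    rw [← LinearMap.ker_eq_bot, Submodule.ker_liftQ_eq_bot _ _ _ hker.le]
  have hrange : LinearMap.range f = LinearMap.range φ := Submodule.range_liftQ _ _ _
  have : Module.IsTorsionFree ℤ (L ⧸ P) := hf.moduleIsTorsionFree f (by simp)
  have hprod : (List.ofFn α).prod =
        ExteriorAlgebra.map P.mkQ.dualMap
          (ExteriorAlgebra.ιMulti ℤ _ fun k => (B.coord k).comp f) ∨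
      (List.ofFn α).prod =
        -ExteriorAlgebra.map P.mkQ.dualMap
          (ExteriorAlgebra.ιMulti ℤ _ fun k => (B.coord k).comp f) := by
    have hlist : ExteriorAlgebra.map P.mkQ.dualMap
          (ExteriorAlgebra.ιMulti ℤ _ fun k => (B.coord k).comp f) =
        (List.ofFn fun i =>
          ExteriorAlgebra.ιMulti ℤ (d i) fun j => ((b i).coord j).comp (K i).mkQ).prod := by
      rw [ExteriorAlgebra.map_apply_ιMulti]
      simp only [ExteriorAlgebra.ιMulti_apply]
      rw [← prod_ofFn_finSigmaFinEquiv d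
        (fun p => ExteriorAlgebra.ι ℤ (((b p.1).coord p.2).comp (K p.1).mkQ))]
      congr 2
    rw [hlist]
    exact prod_ofFn_eq_or_eq_neg α _
      fun i => eq_or_eq_neg_of_span_singleton_eq_span_ιMulti _ _
        ((hα i).trans (extSubPow_dualAnnihilator (K i) (b i)))
  rw [hfin]
  constructor
  · intro hlt
    have hdep : ¬ LinearIndependent ℤ fun k => (B.coord k).comp f := fun hli => by
      have := hli.fintype_card_le_finrank
      rw [Fintype.card_fin, Module.finrank_linearMap_self] at this
      exact absurd hlt this.not_gt
    have h0 := congrArg Subtype.val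
      ((exteriorPower.ιMulti ℤ (∑ i, d i)).map_linearDependent _ hdep)
    rw [exteriorPower.ιMulti_apply_coe] at h0
    rw [h0] at hprod
    simpa using hprod
  · intro heq
    let c : Basis (Fin (∑ i, d i)) ℤ (L ⧸ P) := finBasisOfFinrankEq ℤ _ heq
    refine ⟨_, (extSubPow_dualAnnihilator P c).symm, ?_⟩
    rw [ExteriorAlgebra.ιMulti_eq_det_smul c.dualBasis, map_smul,
      ExteriorAlgebra.map_apply_ιMulti, Basis.coe_dualBasis] at hprod
    change _ = _ • ExteriorAlgebra.ιMulti ℤ _ (fun i => (c.coord i).comp P.mkQ) ∨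
      _ = -(_ • ExteriorAlgebra.ιMulti ℤ _ (fun i => (c.coord i).comp P.mkQ)) at hprod
    have hcard := natAbs_det_eq_card_quotient_range c B f hf
    rw [hrange] at hcard
    rw [← hcard]
    rcases Int.natAbs_eq (c.dualBasis.det fun k => (B.coord k).comp f) with h | h
    · rwa [← h]
    · rw [h, neg_smul, neg_neg] at hprod
      exact hprod.symm
end

section
/- Let L be a free ℤ-module of finite rank r and let K_1,…,K_s ⊆ L be saturated submodules with d_i := rank L − rank K_i and d_1 + ⋯ + d_s = r. Let α_i be a generator of Λ^{d_i}(Ann K_i) and α_i^□ ∈ Λ^{2d_i}(Hom(L,ℤ)⊕Hom(L,ℤ)) its square. Let Θ be a generator of Λ^r Hom(L,ℤ) and let Tr_L : Λ^*(Hom(L,ℤ)⊕Hom(L,ℤ)) → ℤ be the ℤ-linear map sending an element to the coefficient of Θ^□ in its top-degree (degree 2r) component. Then Tr_L(α_1^□∧⋯∧α_s^□) = w², where w is the index (cardinality of the cokernel) of the natural map L → ⊕_{i=1}^s L/K_i if this map is injective (equivalently, K_1 ∩ ⋯ ∩ K_s = 0), and w := 0 otherwise. -/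
set_option synthInstance.maxHeartbeats 1000000
set_option maxHeartbeats 1000000

open Module
open scoped Classical

/-- The squaring operation `α ↦ α^□` sending (a degree-`k` element of) `Λ^* V` to
`Λ^*(V ⊕ V)`; for decomposable `α = a_1∧⋯∧a_k` this equals
`((a_1,0)∧(0,a_1))∧⋯∧((a_k,0)∧(0,a_k))`. -/
noncomputable def extSq {V : Type} [AddCommGroup V] (k : ℕ) (x : ExteriorAlgebra ℤ V) :
    ExteriorAlgebra ℤ (V × V) :=
  ((-1 : ℤ) ^ (k * (k - 1) / 2)) •
    (ExteriorAlgebra.map (LinearMap.inl ℤ V V) x * ExteriorAlgebra.map (LinearMap.inr ℤ V V) x)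

theorem exists_equiv_sigma_prod_ofFn {s r : ℕ} (d : Fin s → ℕ) (hsum : ∑ i, d i = r) :
    ∃ σ : Fin r ≃ (Σ i, Fin (d i)), ∀ {M : Type} [Monoid M] (f : (Σ i, Fin (d i)) → M),
      (List.ofFn fun i => (List.ofFn fun j => f ⟨i, j⟩).prod).prod
        = (List.ofFn fun k => f (σ k)).prod := by
  set l : List (Σ i, Fin (d i)) := (List.finRange s).sigma fun i => List.finRange (d i) with hl
  have hnd : l.Nodup := (List.nodup_finRange s).sigma fun i => List.nodup_finRange (d i)
  have hmem : ∀ x, x ∈ l := fun ⟨i, j⟩ => by simp [hl, List.mem_sigma]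
  have hlen : l.length = r := by
    have := Fintype.card_congr (hnd.getEquivOfForallMemList l hmem)
    simpa [hsum] using this
  refine ⟨(finCongr hlen.symm).trans (hnd.getEquivOfForallMemList l hmem), fun f => ?_⟩
  have hr : (List.ofFn fun k => f (((finCongr hlen.symm).trans
      (hnd.getEquivOfForallMemList l hmem)) k)) = l.map f := by
    refine List.ext_getElem (by simp [hlen]) fun n h₁ h₂ => ?_
    simp [List.Nodup.getEquivOfForallMemList]
  rw [hr, hl, List.ofFn_eq_map]
  clear hr hlen hmem hnd hl
  induction List.finRange s with
  | nil => simp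
  | cons a t ih =>
    rw [List.map_cons, List.prod_cons, ih, List.sigma_cons, List.map_append, List.prod_append]
    simp [List.ofFn_eq_map, Function.comp_def]

theorem List.prod_map_zsmul {ι A : Type*} [Ring A] (l : List ι) (a : ι → ℤ) (p : ι → A) :
    (l.map fun i => a i • p i).prod = (l.map a).prod • (l.map p).prod := by
  induction l with
  | nil => simp
  | cons x t ih =>
    simp only [List.map_cons, List.prod_cons]
    rw [ih, smul_mul_assoc, mul_smul_comm, smul_smul]

theorem AlternatingMap.map_eq_det_smul {R M N ι : Type*} [CommRing R] [AddCommGroup M] [Module R M]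
    [AddCommGroup N] [Module R N] [Fintype ι] [DecidableEq ι] (f : M [⋀^ι]→ₗ[R] N)
    (b : Basis ι R M) (v : ι → M) : f v = b.det v • f b := by
  have : f = (LinearMap.toSpanSingleton R N (f b)).compAlternatingMap b.det := by
    refine Basis.ext_alternating b fun w hw => ?_
    obtain ⟨σ, rfl⟩ : ∃ σ : Equiv.Perm ι, w = σ :=
      ⟨Equiv.ofBijective w (Finite.injective_iff_bijective.mp hw), rfl⟩
    have h₁ := f.map_perm b σ
    have h₂ := b.det.map_perm b σ
    simp only [Function.comp_def] at h₁ h₂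
    simp [h₁, h₂, b.det_self]
  conv_lhs => rw [this]
  simp

theorem extSubPow_eq_span {V : Type} [AddCommGroup V] (W : Submodule ℤ V) {d : ℕ}
    (b : Basis (Fin d) ℤ W) :
    extSubPow W d = Submodule.span ℤ {ExteriorAlgebra.ιMulti ℤ d fun i => (b i : V)} := by
  have hmap : Submodule.map (ExteriorAlgebra.ι ℤ) W =
      Submodule.map (ExteriorAlgebra.map W.subtype).toLinearMap
        (LinearMap.range (ExteriorAlgebra.ι ℤ : W →ₗ[ℤ] _)) := by
    rw [ExteriorAlgebra.ι_range_map_map, W.range_subtype]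
  rw [extSubPow, hmap, ← Submodule.map_pow]
  change Submodule.map _ (⋀[ℤ]^d W) = _
  rw [← ExteriorAlgebra.ιMulti_span_fixedDegree, Submodule.map_span]
  apply le_antisymm
  · rw [Submodule.span_le]
    rintro _ ⟨_, ⟨v, rfl⟩, rfl⟩
    rw [SetLike.mem_coe, Submodule.mem_span_singleton]
    refine ⟨b.det v, ?_⟩
    rw [AlternatingMap.map_eq_det_smul (ExteriorAlgebra.ιMulti ℤ d) b v, map_smul]
    simp [ExteriorAlgebra.map_apply_ιMulti, Function.comp_def]
  · rw [Submodule.span_singleton_le_iff_mem]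
    refine Submodule.subset_span ⟨_, ⟨b, rfl⟩, ?_⟩
    simp [ExteriorAlgebra.map_apply_ιMulti, Function.comp_def]

theorem natAbs_det_toMatrix_eq_card_quotient_range {M N ι : Type*} [AddCommGroup M]
    [AddCommGroup N] [Fintype ι] [DecidableEq ι] (b : Basis ι ℤ M) (c : Basis ι ℤ N)
    (f : M →ₗ[ℤ] N) :
    (LinearMap.toMatrix b c f).det.natAbs
      = if Function.Injective f then Nat.card (N ⧸ LinearMap.range f) else 0 := by
  split_ifs with h
  · have := Module.Free.of_basis c
    have := Module.Finite.of_basis c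
    have key := Submodule.natAbs_det_basis_change c (LinearMap.range f)
      (b.map (LinearEquiv.ofInjective f h))
    rw [← key, Basis.det_apply]
    congr 2
    ext i j
    simp [LinearMap.toMatrix_apply, Basis.toMatrix_apply]
  · rw [Int.natAbs_eq_zero]
    by_contra hdet
    refine h (LinearMap.ker_eq_bot.mp (LinearMap.ker_eq_bot'.mpr fun m hm => ?_))
    have := Matrix.eq_zero_of_mulVec_eq_zero hdet
      (v := b.repr m) (by rw [LinearMap.toMatrix_mulVec_repr, hm]; simp)
    simpa using this

section Square

variable {V : Type} [AddCommGroup V]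

theorem ExteriorAlgebra.list_prod_mul_ι (l : List V) (v : V) :
    (l.map (ExteriorAlgebra.ι ℤ)).prod * ExteriorAlgebra.ι ℤ v
      = ((-1 : ℤ) ^ l.length) • (ExteriorAlgebra.ι ℤ v * (l.map (ExteriorAlgebra.ι ℤ)).prod) := by
  induction l with
  | nil => simp
  | cons a t ih =>
    have h := eq_neg_of_add_eq_zero_left (ExteriorAlgebra.ι_add_mul_swap (R := ℤ) a v)
    rw [List.map_cons, List.prod_cons, mul_assoc, ih, mul_smul_comm, ← mul_assoc, h,
      List.length_cons, pow_succ, mul_smul]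
    simp [mul_assoc]

theorem extSq_zsmul (k : ℕ) (a : ℤ) (x : ExteriorAlgebra ℤ V) :
    extSq k (a • x) = (a ^ 2) • extSq k x := by
  simp only [extSq, map_zsmul, smul_mul_assoc, mul_smul_comm, smul_smul]
  congr 1
  ring

theorem extSq_list_prod (l : List V) :
    extSq l.length (l.map (ExteriorAlgebra.ι ℤ)).prod
      = (l.map fun a => ExteriorAlgebra.ι ℤ ((a, 0) : V × V)
          * ExteriorAlgebra.ι ℤ ((0, a) : V × V)).prod := by
  induction l with
  | nil => simp [extSq]
  | cons a t ih =>
    have hsign : (t.length + 1) * (t.length + 1 - 1) / 2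
        = t.length + t.length * (t.length - 1) / 2 := by
      have := Nat.triangle_succ t.length
      omega
    have hcomm := ExteriorAlgebra.list_prod_mul_ι (t.map (LinearMap.inl ℤ V V)) ((0, a) : V × V)
    have hinl : ExteriorAlgebra.map (LinearMap.inl ℤ V V) (t.map (ExteriorAlgebra.ι ℤ)).prod
        = ((t.map (LinearMap.inl ℤ V V)).map (ExteriorAlgebra.ι ℤ)).prod := by
      simp [map_list_prod, Function.comp_def]
    rw [List.map_cons, List.prod_cons, List.map_cons, List.prod_cons, ← ih, extSq, extSq,
      List.length_cons, hsign, map_mul, map_mul, ExteriorAlgebra.map_apply_ι,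
      ExteriorAlgebra.map_apply_ι, hinl]
    rw [List.length_map] at hcomm
    rw [LinearMap.inr_apply, LinearMap.inl_apply, mul_assoc, ← mul_assoc _ (ExteriorAlgebra.ι ℤ _),
      hcomm, pow_add, smul_mul_assoc, mul_smul_comm, smul_smul, mul_smul_comm, mul_right_comm,
      ← mul_pow]
    simp [mul_assoc]

theorem extSq_prod_ofFn {k : ℕ} (v : Fin k → V) :
    extSq k (List.ofFn fun i => ExteriorAlgebra.ι ℤ (v i)).prod
      = (List.ofFn fun i => ExteriorAlgebra.ι ℤ ((v i, 0) : V × V)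
          * ExteriorAlgebra.ι ℤ ((0, v i) : V × V)).prod := by
  simpa [List.map_ofFn, Function.comp_def] using extSq_list_prod (List.ofFn v)

theorem extSq_mem {k : ℕ} {x : ExteriorAlgebra ℤ V} (hx : x ∈ ⋀[ℤ]^k V) :
    extSq k x ∈ ⋀[ℤ]^(2 * k) (V × V) := by
  have hmap (f : V →ₗ[ℤ] V × V) : ExteriorAlgebra.map f x ∈ ⋀[ℤ]^k (V × V) := by
    have h := Submodule.mem_map_of_mem (f := (ExteriorAlgebra.map f).toLinearMap) hx
    rw [ExteriorAlgebra.exteriorPower, Submodule.map_pow, ExteriorAlgebra.ι_range_map_map] at h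
    exact pow_le_pow_left' LinearMap.map_le_range k h
  rw [two_mul]
  refine Submodule.smul_mem _ _ ?_
  rw [ExteriorAlgebra.exteriorPower, pow_add]
  exact Submodule.mul_mem_mul (hmap _) (hmap _)

end Square

/-- **Lemma `Trop2Wedge`**: with `L` free of rank `r`, `K i ⊆ L` saturated of corank `d i`,
`∑ d i = r`, `α i` a generator of `Λ^{d i}(Ann (K i))`, `Θ` a generator of `Λ^r Hom(L,ℤ)` and
`Tr_L` the trace sending an element of `Λ^*(Hom(L,ℤ)⊕Hom(L,ℤ))` to the coefficient of `Θ^□` in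
its degree-`2r` component, one has `Tr_L(α_1^□ ∧ ⋯ ∧ α_s^□) = w²`, where `w` is the index of
the map `L → ⊕ᵢ L ⧸ K i` when this map is injective, and `w = 0` otherwise. -/
theorem trop2wedge (L : Type) [AddCommGroup L] [Module.Free ℤ L] [Module.Finite ℤ L]
    (r : ℕ) (hr : r = finrank ℤ L)
    (s : ℕ) (K : Fin s → Submodule ℤ L)
    (hsat : ∀ i, NoZeroSMulDivisors ℤ (L ⧸ K i))
    (d : Fin s → ℕ) (hd : ∀ i, d i = finrank ℤ L - finrank ℤ (K i))
    (hsum : ∑ i, d i = r)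
    (α : Fin s → ExteriorAlgebra ℤ (Module.Dual ℤ L))
    (hα : ∀ i, Submodule.span ℤ {α i} = extSubPow ((K i).dualAnnihilator) (d i))
    (Θ : ExteriorAlgebra ℤ (Module.Dual ℤ L))
    (hΘ : Submodule.span ℤ {Θ} = extSubPow (⊤ : Submodule ℤ (Module.Dual ℤ L)) r)
    (Tr : ExteriorAlgebra ℤ (Module.Dual ℤ L × Module.Dual ℤ L) →ₗ[ℤ] ℤ)
    (hTr : ∀ (x : ExteriorAlgebra ℤ (Module.Dual ℤ L × Module.Dual ℤ L)) (c : ℤ),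
      GradedAlgebra.proj (fun i : ℕ => ⋀[ℤ]^i (Module.Dual ℤ L × Module.Dual ℤ L)) (2 * r) x
        = c • extSq r Θ → Tr x = c)
    (w : ℕ)
    (hw : w = if _h : Function.Injective (LinearMap.pi fun i => (K i).mkQ : L →ₗ[ℤ] ∀ i, L ⧸ K i)
      then Nat.card ((∀ i, L ⧸ K i) ⧸
        LinearMap.range (LinearMap.pi fun i => (K i).mkQ)) else 0) :
    Tr (List.ofFn fun i => extSq (d i) (α i)).prod = (w : ℤ) ^ 2 := by
  subst hw
  have hfree (i) : Module.Free ℤ (L ⧸ K i) := by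
    have := hsat i
    infer_instance
  have hrank (i) : finrank ℤ (L ⧸ K i) = d i := by
    rw [hd i, ← (K i).finrank_quotient_add_finrank, Nat.add_sub_cancel]
  let e (i) : Basis (Fin (d i)) ℤ (L ⧸ K i) := finBasisOfFinrankEq ℤ _ (hrank i)
  let c₀ : Basis (Fin r) ℤ L := finBasisOfFinrankEq ℤ L hr.symm
  let c : Basis (Fin r) ℤ (Dual ℤ L) := c₀.dualBasis
  let b : (Σ i, Fin (d i)) → Dual ℤ L := fun x => (e x.1).coord x.2 ∘ₗ (K x.1).mkQ
  let p (i) : ExteriorAlgebra ℤ (Dual ℤ L) :=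
    (List.ofFn fun j => ExteriorAlgebra.ι ℤ (b ⟨i, j⟩)).prod
  have hαp (i) : Submodule.span ℤ {α i} = Submodule.span ℤ {p i} := by
    rw [hα i, extSubPow_eq_span _ ((e i).dualBasis.map (K i).dualQuotEquivDualAnnihilator),
      ExteriorAlgebra.ιMulti_apply]
    congr! 7
    ext x
    simp [b]
    rfl
  have hΘc : Submodule.span ℤ {Θ} = Submodule.span ℤ {ExteriorAlgebra.ιMulti ℤ r c} := by
    rw [hΘ, extSubPow_eq_span _ (c.map Submodule.topEquiv.symm)]
    rfl
  have hmem (x y : ExteriorAlgebra ℤ (Dual ℤ L))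
      (h : Submodule.span ℤ {x} = Submodule.span ℤ {y}) : ∃ a : ℤ, x = a • y := by
    obtain ⟨a, ha⟩ := Submodule.mem_span_singleton.mp (h ▸ Submodule.mem_span_singleton_self x)
    exact ⟨a, ha.symm⟩
  choose a ha using fun i => hmem _ _ (hαp i)
  choose a' ha' using fun i => hmem _ _ (hαp i).symm
  obtain ⟨t, ht⟩ := hmem _ _ hΘc.symm
  obtain ⟨σ, hσ⟩ := exists_equiv_sigma_prod_ofFn d hsum
  let A : ExteriorAlgebra ℤ (Dual ℤ L) := (List.ofFn α).prod
  let v : Fin r → Dual ℤ L := fun k => b (σ k)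
  have hp : (List.ofFn p).prod = ExteriorAlgebra.ιMulti ℤ r v := by
    rw [ExteriorAlgebra.ιMulti_apply]
    exact hσ fun x => ExteriorAlgebra.ι ℤ (b x)
  have hsmul {B : Type} [Ring B] (m : Fin s → ℤ) (q : Fin s → B) :
      (List.ofFn fun i => m i • q i).prod = (List.ofFn m).prod • (List.ofFn q).prod := by
    simp only [List.ofFn_eq_map]
    exact List.prod_map_zsmul _ _ _
  have hA : A = (List.ofFn a).prod • ExteriorAlgebra.ιMulti ℤ r v := by
    rw [← hp, ← hsmul]
    exact congrArg (fun q => (List.ofFn q).prod) (funext ha)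
  have hA' : ExteriorAlgebra.ιMulti ℤ r v = (List.ofFn a').prod • A := by
    rw [← hp, ← hsmul]
    exact congrArg (fun q => (List.ofFn q).prod) (funext ha')
  have hsq : (List.ofFn fun i => extSq (d i) (α i)).prod = extSq r A := by
    have h₁ : (fun i => extSq (d i) (α i)) = fun i => (a i ^ 2) • extSq (d i) (p i) := by
      funext i
      rw [ha i, extSq_zsmul]
    have h₂ : (List.ofFn fun i => a i ^ 2).prod = (List.ofFn a).prod ^ 2 := by
      simp only [List.prod_ofFn, Finset.prod_pow]
    rw [h₁, hsmul, hA, extSq_zsmul, h₂, ExteriorAlgebra.ιMulti_apply, extSq_prod_ofFn]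
    simp only [p, extSq_prod_ofFn]
    congr 1
    exact hσ fun x => ExteriorAlgebra.ι ℤ ((b x, 0) : Dual ℤ L × Dual ℤ L)
      * ExteriorAlgebra.ι ℤ ((0, b x) : Dual ℤ L × Dual ℤ L)
  let φ : ExteriorAlgebra ℤ (Dual ℤ L) →ₗ[ℤ] ℤ :=
    ExteriorAlgebra.liftAlternating (Pi.single r c.det)
  have hφ (u : Fin r → Dual ℤ L) : φ (ExteriorAlgebra.ιMulti ℤ r u) = c.det u := by
    simp [φ, ExteriorAlgebra.liftAlternating_apply_ιMulti]
  obtain ⟨t', ht'⟩ := hmem _ _ hΘc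
  have hm : A = ((List.ofFn a).prod * c.det v * t) • Θ := by
    rw [hA, AlternatingMap.map_eq_det_smul _ c v, ht, smul_smul, smul_smul, mul_assoc]
  have hΘmem : Θ ∈ ⋀[ℤ]^r (Dual ℤ L) := by
    rw [ht']
    refine Submodule.smul_mem _ _ ?_
    rw [← ExteriorAlgebra.ιMulti_span_fixedDegree]
    exact Submodule.subset_span ⟨_, rfl⟩
  have hD : c.det v = (List.ofFn a').prod * ((List.ofFn a).prod * c.det v) := by
    have h := congrArg φ hA'
    rw [hA, map_smul, map_smul, hφ] at h
    simpa using h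
  have htt : t * t' = 1 := by
    have h := congrArg φ ht
    rw [ht', map_smul, map_smul, hφ, c.det_self] at h
    simpa using h.symm
  have hDw : (c.det v).natAbs = if Function.Injective
      (LinearMap.pi fun i => (K i).mkQ : L →ₗ[ℤ] ∀ i, L ⧸ K i)
      then Nat.card ((∀ i, L ⧸ K i) ⧸ LinearMap.range (LinearMap.pi fun i => (K i).mkQ))
      else 0 := by
    rw [← natAbs_det_toMatrix_eq_card_quotient_range c₀ ((Pi.basis e).reindex σ.symm), c.det_apply,
      ← Matrix.det_transpose]
    congr 2
    ext i j
    simp [LinearMap.toMatrix_apply, Basis.toMatrix_apply, c, v, b]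
  rw [hsq, hm, extSq_zsmul, map_smul, hTr (extSq r Θ) 1 ?_]
  · rw [dite_eq_ite, ← hDw, Int.natCast_natAbs, sq_abs, smul_eq_mul, mul_one]
    have ht2 : t ^ 2 = 1 := by
      rcases Int.isUnit_iff.mp (IsUnit.of_mul_eq_one _ htt) with h | h <;> simp [h]
    rcases eq_or_ne (c.det v) 0 with h0 | h0
    · simp [h0]
    · have haa : (List.ofFn a).prod * (List.ofFn a').prod = 1 := by
        apply mul_right_cancel₀ h0
        linear_combination -hD
      have ha2 : (List.ofFn a).prod ^ 2 = 1 := by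
        rcases Int.isUnit_iff.mp (IsUnit.of_mul_eq_one _ haa) with h | h <;> simp [h]
      rw [mul_pow, mul_pow, ht2, ha2]
      ring
  · rw [one_smul, GradedAlgebra.proj_apply,
      DirectSum.decompose_of_mem_same
        (fun i : ℕ => ⋀[ℤ]^i (Dual ℤ L × Dual ℤ L)) (extSq_mem hΘmem)]
end

section
/- Let N be a lattice of rank r with dual M := Hom_ℤ(N,ℤ) and let n ∈ N be nonzero of index |n| (so n = |n|·n′ with n′ primitive). Set M_n := {m ∈ M : m(n) = 0}, 𝒞_0 := Λ^*(M⊕M), 𝒞_n := Λ^*(M_n⊕M_n) ⊆ 𝒞_0. Let Tr_0 : 𝒞_0 → ℤ and Tr_n : 𝒞_n → ℤ be the traces sending an element to the coefficient of Θ_0^□ (respectively Θ_n^□) in its top-degree component, where Θ_0 generates Λ^r M and Θ_n generates Λ^{r−1} M_n. Define κ_n : 𝒞_n → 𝒞_0 as |n|² times the inclusion, and κ_n^∨ := ι_{(0,n)} ∘ ι_{(n,0)} : 𝒞_0 → 𝒞_n. Then κ_n^∨ is adjoint to κ_n with respect to the Frobenius traces: for all a ∈ 𝒞_0 and all b ∈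 𝒞_n, Tr_n(κ_n^∨(a) ∧ b) = Tr_0(a ∧ κ_n(b)). -/
set_option synthInstance.maxHeartbeats 1000000
set_option maxHeartbeats 1000000

open Module

/-- `n ∈ N` is primitive: it is not a positive multiple of any other lattice element. -/
def IsPrimitiveElt {N : Type} [AddCommGroup N] (n : N) : Prop :=
  ∀ (k : ℤ), 0 < k → ∀ m : N, n = k • m → k = 1

/-- The contraction `ι_{(n,0)∧(0,n)} = ι_{(0,n)} ∘ ι_{(n,0)}` on `Λ^*(M ⊕ M)`,
`M := Hom(N, ℤ)`; this is the map `κ_n^∨ : 𝒞_0 → 𝒞_n` of the multiplicity TrQFT. -/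
noncomputable def kappaVee {N : Type} [AddCommGroup N] (n : N) :
    ExteriorAlgebra ℤ (Module.Dual ℤ N × Module.Dual ℤ N) →ₗ[ℤ]
      ExteriorAlgebra ℤ (Module.Dual ℤ N × Module.Dual ℤ N) :=
  (CliffordAlgebra.contractLeft
      ((Module.Dual.eval ℤ N n).comp (LinearMap.snd ℤ (Module.Dual ℤ N) (Module.Dual ℤ N)) :
        Module.Dual ℤ (Module.Dual ℤ N × Module.Dual ℤ N))) ∘ₗ
  (CliffordAlgebra.contractLeft
      ((Module.Dual.eval ℤ N n).comp (LinearMap.fst ℤ (Module.Dual ℤ N) (Module.Dual ℤ N)) :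
        Module.Dual ℤ (Module.Dual ℤ N × Module.Dual ℤ N)))

/-- The subalgebra `𝒞_n = Λ^*(M_n ⊕ M_n)` of `𝒞_0 = Λ^*(M ⊕ M)` (as a submodule). -/
noncomputable def Cn {N : Type} [AddCommGroup N] (n : N) :
    Submodule ℤ (ExteriorAlgebra ℤ (Module.Dual ℤ N × Module.Dual ℤ N)) :=
  Subalgebra.toSubmodule (Algebra.adjoin ℤ
    ((Submodule.map (ExteriorAlgebra.ι ℤ)
      ((LinearMap.ker (Module.Dual.eval ℤ N n)).prod
        (LinearMap.ker (Module.Dual.eval ℤ N n))) :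
        Submodule ℤ (ExteriorAlgebra ℤ (Module.Dual ℤ N × Module.Dual ℤ N))) : Set _))

open CliffordAlgebra in
/-- If `b` is killed by contraction with `d`, contraction is right `b`-linear. -/
lemma contractLeft_mul_of_eq_zero {R V : Type*} [CommRing R] [AddCommGroup V] [Module R V]
    (d : Module.Dual R V) (a : ExteriorAlgebra R V) {b : ExteriorAlgebra R V}
    (hb : contractLeft d b = 0) : contractLeft d (a * b) = contractLeft d a * b := by
  induction a using CliffordAlgebra.left_induction with
  | algebraMap r =>
    rw [contractLeft_algebraMap_mul, hb, contractLeft_algebraMap, mul_zero, zero_mul]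
  | add x y hx hy => rw [add_mul, map_add, hx, hy, map_add, add_mul]
  | ι_mul x m hx =>
    rw [mul_assoc, contractLeft_ι_mul, hx, contractLeft_ι_mul, sub_mul, smul_mul_assoc, mul_assoc]

open CliffordAlgebra in
/-- Contraction with `d` kills the subalgebra generated by a submodule of the kernel of `d`. -/
lemma contractLeft_eq_zero_of_mem_adjoin {R V : Type*} [CommRing R] [AddCommGroup V] [Module R V]
    (d : Module.Dual R V) {W : Submodule R V} (hW : W ≤ LinearMap.ker d)
    {b : ExteriorAlgebra R V}
    (hb : b ∈ Algebra.adjoin R ((W.map (ExteriorAlgebra.ι R) : Submodule R _) : Set _)) :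
    contractLeft d b = 0 := by
  induction hb using Algebra.adjoin_induction with
  | mem x hx =>
    obtain ⟨w, hw, rfl⟩ := hx
    have h := hW hw
    rw [LinearMap.mem_ker] at h
    change contractLeft d (CliffordAlgebra.ι _ w) = 0
    rw [contractLeft_ι, h, map_zero]
  | algebraMap r => exact contractLeft_algebraMap _ _ r
  | add x y _ _ hx hy => rw [map_add, hx, hy, add_zero]
  | mul x y _ _ hx hy => rw [contractLeft_mul_of_eq_zero d x hy, hx, zero_mul]

open CliffordAlgebra in
/-- Contraction with `d` maps the subalgebra generated by `W` to the subalgebra generated by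
`W ⊓ ker d`, provided that `d` takes the value `1` on `W`. -/
lemma contractLeft_mem_adjoin_inf_ker {R V : Type*} [CommRing R] [AddCommGroup V] [Module R V]
    (d : Module.Dual R V) {W : Submodule R V} {e : V} (heW : e ∈ W) (he : d e = 1)
    {x : ExteriorAlgebra R V}
    (hx : x ∈ Algebra.adjoin R ((W.map (ExteriorAlgebra.ι R) : Submodule R _) : Set _)) :
    contractLeft d x ∈ Algebra.adjoin R
      (((W ⊓ LinearMap.ker d).map (ExteriorAlgebra.ι R) :
        Submodule R (ExteriorAlgebra R V)) : Set (ExteriorAlgebra R V)) := by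
  set A := Algebra.adjoin R
      (((W ⊓ LinearMap.ker d).map (ExteriorAlgebra.ι R) :
        Submodule R (ExteriorAlgebra R V)) : Set (ExteriorAlgebra R V)) with hA
  have hA0 : ∀ p ∈ A, contractLeft d p = 0 := fun p hp =>
    contractLeft_eq_zero_of_mem_adjoin d inf_le_right hp
  have key : ∃ p ∈ A, ∃ q ∈ A, x = p + ExteriorAlgebra.ι R e * q := by
    have gen : ∀ w ∈ W, ∀ p ∈ A, ∀ q ∈ A, ∃ p' ∈ A, ∃ q' ∈ A,
        ExteriorAlgebra.ι R w * (p + ExteriorAlgebra.ι R e * q)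
          = p' + ExteriorAlgebra.ι R e * q' := by
      intro w hw p hp q hq
      have hu : ExteriorAlgebra.ι R (w - d w • e) ∈ A := by
        refine Algebra.subset_adjoin ⟨_, ⟨W.sub_mem hw (W.smul_mem _ heW), ?_⟩, rfl⟩
        simp [he]
      refine ⟨_, A.mul_mem hu hp, _, A.sub_mem (A.smul_mem hp (d w)) (A.mul_mem hu hq), ?_⟩
      have hw' : ExteriorAlgebra.ι R w
          = ExteriorAlgebra.ι R (w - d w • e) + d w • ExteriorAlgebra.ι R e := by
        rw [← map_smul, ← map_add, sub_add_cancel]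
      have hsw : ExteriorAlgebra.ι R (w - d w • e) * ExteriorAlgebra.ι R e
          = -(ExteriorAlgebra.ι R e * ExteriorAlgebra.ι R (w - d w • e)) :=
        eq_neg_of_add_eq_zero_left (ExteriorAlgebra.ι_add_mul_swap _ _)
      have hsq := ExteriorAlgebra.ι_sq_zero (R := R) e
      generalize ExteriorAlgebra.ι R (w - d w • e) = u at *
      generalize ExteriorAlgebra.ι R e = f at *
      rw [hw', add_mul, mul_add, mul_add, ← mul_assoc u, hsw, smul_mul_assoc, smul_mul_assoc,
        ← mul_assoc f f, hsq, zero_mul, smul_zero, add_zero, mul_sub, mul_smul_comm, neg_mul,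
        mul_assoc]
      abel
    have mul : ∀ p ∈ A, ∀ q ∈ A, ∃ p' ∈ A, ∃ q' ∈ A,
        x * (p + ExteriorAlgebra.ι R e * q) = p' + ExteriorAlgebra.ι R e * q' := by
      induction hx using Algebra.adjoin_induction with
      | mem x hx =>
        obtain ⟨w, hw, rfl⟩ := hx
        exact gen w hw
      | algebraMap r =>
        intro p hp q hq
        refine ⟨_, A.smul_mem hp r, _, A.smul_mem hq r, ?_⟩
        rw [← Algebra.smul_def, smul_add, mul_smul_comm]
      | add x y _ _ hx hy =>
        intro p hp q hq
        obtain ⟨p₁, hp₁, q₁, hq₁, h₁⟩ := hx p hp q hq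
        obtain ⟨p₂, hp₂, q₂, hq₂, h₂⟩ := hy p hp q hq
        refine ⟨_, A.add_mem hp₁ hp₂, _, A.add_mem hq₁ hq₂, ?_⟩
        rw [add_mul, h₁, h₂, mul_add]
        abel
      | mul x y _ _ hx hy =>
        intro p hp q hq
        obtain ⟨p₁, hp₁, q₁, hq₁, h₁⟩ := hy p hp q hq
        rw [mul_assoc, h₁]
        exact hx p₁ hp₁ q₁ hq₁
    simpa using mul 1 A.one_mem 0 A.zero_mem
  obtain ⟨p, hp, q, hq, rfl⟩ := key
  have : contractLeft d (ExteriorAlgebra.ι R e * q) = q := by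
    refine (contractLeft_ι_mul d e q).trans ?_
    rw [he, hA0 q hq, mul_zero, sub_zero, one_smul]
  rwa [map_add, hA0 p hp, this, zero_add]

open CliffordAlgebra in
/-- Contraction lowers the degree by one. -/
lemma contractLeft_mem_exteriorPower {R V : Type*} [CommRing R] [AddCommGroup V] [Module R V]
    (d : Module.Dual R V) (k : ℕ) {x : ExteriorAlgebra R V} (hx : x ∈ ⋀[R]^(k + 1) V) :
    contractLeft d x ∈ ⋀[R]^k V := by
  induction k generalizing x with
  | zero =>
    rw [ExteriorAlgebra.exteriorPower, zero_add, pow_one] at hx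
    obtain ⟨v, rfl⟩ := hx
    rw [ExteriorAlgebra.exteriorPower, pow_zero, Submodule.mem_one]
    refine ⟨d v, ?_⟩
    exact (contractLeft_ι 0 d v).symm
  | succ k ih =>
    rw [ExteriorAlgebra.exteriorPower, pow_succ'] at hx
    induction hx using Submodule.mul_induction_on' with
    | mem_mul_mem m hm y hy =>
      obtain ⟨v, rfl⟩ := hm
      have h := contractLeft_ι_mul d v y
      refine h ▸ Submodule.sub_mem _ (Submodule.smul_mem _ _ hy) ?_
      rw [ExteriorAlgebra.exteriorPower, pow_succ']
      exact Submodule.mul_mem_mul ⟨v, rfl⟩ (ih hy)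
    | add x _ y _ hx hy => rw [map_add]; exact Submodule.add_mem _ hx hy

open CliffordAlgebra in
lemma contractLeft_eq_zero_of_mem_exteriorPower_zero {R V : Type*} [CommRing R] [AddCommGroup V]
    [Module R V] (d : Module.Dual R V) {x : ExteriorAlgebra R V} (hx : x ∈ ⋀[R]^0 V) :
    contractLeft d x = 0 := by
  rw [ExteriorAlgebra.exteriorPower, pow_zero, Submodule.mem_one] at hx
  obtain ⟨r, rfl⟩ := hx
  exact contractLeft_algebraMap _ _ r

/-- Submodules of degree-one elements of an exterior algebra commute. -/
lemma commute_map_ι {R V : Type*} [CommRing R] [AddCommGroup V] [Module R V]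
    (P Q : Submodule R V) :
    Commute (P.map (ExteriorAlgebra.ι R)) (Q.map (ExteriorAlgebra.ι R)) := by
  have aux : ∀ P Q : Submodule R V, P.map (ExteriorAlgebra.ι R) * Q.map (ExteriorAlgebra.ι R)
      ≤ Q.map (ExteriorAlgebra.ι R) * P.map (ExteriorAlgebra.ι R) := by
    intro P Q
    rw [Submodule.mul_le]
    rintro _ ⟨p, hp, rfl⟩ _ ⟨q, hq, rfl⟩
    rw [eq_neg_of_add_eq_zero_left (ExteriorAlgebra.ι_add_mul_swap p q)]
    exact Submodule.neg_mem _ (Submodule.mul_mem_mul ⟨q, hq, rfl⟩ ⟨p, hp, rfl⟩)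
  exact le_antisymm (aux P Q) (aux Q P)

/-- In the binomial expansion of a power of a sum of two commuting submodules, with all but one
term vanishing, the power is contained in the remaining term. -/
lemma sup_pow_le_of_commute {R A : Type*} [CommRing R] [Ring A] [Algebra R A]
    {P Q : Submodule R A} (h : Commute P Q) {i j : ℕ} (hP : P ^ (i + 1) = 0)
    (hQ : Q ^ (j + 1) = 0) : (P ⊔ Q) ^ (i + j) ≤ P ^ i * Q ^ j := by
  rw [← Submodule.add_eq_sup, h.add_pow']
  refine (Finset.sum_eq_single (i, j) ?_ ?_).trans_le ?_
  · rintro ⟨k, l⟩ hkl hne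
    rw [Finset.HasAntidiagonal.mem_antidiagonal] at hkl
    dsimp only at hkl ⊢
    rcases lt_trichotomy k i with hk | hk | hk
    · obtain ⟨t, rfl⟩ := Nat.exists_eq_add_of_le (show j + 1 ≤ l by omega)
      rw [pow_add Q, hQ, zero_mul, mul_zero, smul_zero]
    · exact absurd (Prod.ext hk (by dsimp only; omega)) hne
    · obtain ⟨t, rfl⟩ := Nat.exists_eq_add_of_le (show i + 1 ≤ k by omega)
      rw [pow_add P, hP, zero_mul, zero_mul, smul_zero]
  · intro hn
    simp at hn
  · have hs : ∀ (n : ℕ) (S : Submodule R A), n • S ≤ S := by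
      intro n S
      induction n with
      | zero => rw [zero_smul]; exact bot_le
      | succ n ih => rw [succ_nsmul, Submodule.add_eq_sup]; exact sup_le ih le_rfl
    exact hs _ _

/-- Exterior powers beyond the rank vanish. -/
lemma map_ι_top_pow_eq_zero {R V : Type*} [CommRing R] [Nontrivial R] [AddCommGroup V]
    [Module R V] [Module.Free R V] [Module.Finite R V] {k : ℕ} (hk : finrank R V < k) :
    ((⊤ : Submodule R V).map (ExteriorAlgebra.ι R)) ^ k = 0 := by
  rw [Submodule.map_top]
  have h := exteriorPower.finrank_eq R k (M := V)
  rw [Nat.choose_eq_zero_of_lt hk] at h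
  rw [Submodule.zero_eq_bot, ← Submodule.subsingleton_iff_eq_bot]
  exact (Module.finrank_eq_zero_iff_of_free R (⋀[R]^k V)).1 h

/-- A primitive element of a finite free `ℤ`-module takes the value `1` at some functional. -/
lemma IsPrimitiveElt.exists_dual_eq_one {N : Type} [AddCommGroup N] [Module.Free ℤ N]
    [Module.Finite ℤ N] {n : N} (hn : IsPrimitiveElt n) : ∃ θ : Module.Dual ℤ N, θ n = 1 := by
  have hn0 : n ≠ 0 := by
    rintro rfl
    exact absurd (hn 2 (by norm_num) 0 (by simp)) (by norm_num)
  obtain ⟨g, hg⟩ := (IsPrincipalIdealRing.principal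
    (LinearMap.range (Module.Dual.eval ℤ N n))).principal
  have hg' : ∀ θ : Module.Dual ℤ N, g ∣ θ n := fun θ => by
    have : θ n ∈ LinearMap.range (Module.Dual.eval ℤ N n) := ⟨θ, rfl⟩
    rw [hg] at this
    exact Ideal.mem_span_singleton.1 this
  let b := Module.Free.chooseBasis ℤ N
  choose f hf using fun i => hg' (b.coord i)
  have hm : n = g • ∑ i, f i • b i := by
    rw [Finset.smul_sum]
    conv_lhs => rw [← b.sum_repr n]
    refine Finset.sum_congr rfl fun i _ => ?_
    rw [smul_smul, ← hf i, Module.Basis.coord_apply]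
  have hg0 : g ≠ 0 := by
    rintro rfl
    exact hn0 (by rw [hm, zero_smul])
  have hgu : IsUnit g := by
    rw [Int.isUnit_iff]
    rcases hg0.lt_or_gt with h | h
    · right
      have := hn (-g) (by omega) (-∑ i, f i • b i) (by rw [smul_neg, neg_smul, neg_neg]; exact hm)
      omega
    · left
      exact hn g h _ hm
  have : (1 : ℤ) ∈ LinearMap.range (Module.Dual.eval ℤ N n) := by
    rw [hg]
    exact Ideal.mem_span_singleton.2 hgu.dvd
  obtain ⟨θ, hθ⟩ := this
  exact ⟨θ, hθ⟩

/-- Moving a vector past an element of degree `k` introduces the sign `(-1) ^ k`. -/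
lemma mul_ι_of_mem_exteriorPower {R V : Type*} [CommRing R] [AddCommGroup V] [Module R V]
    (v : V) (k : ℕ) {y : ExteriorAlgebra R V} (hy : y ∈ ⋀[R]^k V) :
    y * ExteriorAlgebra.ι R v = (-1 : ℤ) ^ k • (ExteriorAlgebra.ι R v * y) := by
  induction k generalizing y with
  | zero =>
    rw [ExteriorAlgebra.exteriorPower, pow_zero, Submodule.mem_one] at hy
    obtain ⟨r, rfl⟩ := hy
    rw [pow_zero, one_smul, Algebra.commutes]
  | succ k ih =>
    rw [ExteriorAlgebra.exteriorPower, pow_succ'] at hy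
    induction hy using Submodule.mul_induction_on' with
    | mem_mul_mem m hm y hy =>
      obtain ⟨w, rfl⟩ := hm
      rw [mul_assoc, ih hy, mul_smul_comm, ← mul_assoc,
        eq_neg_of_add_eq_zero_left (ExteriorAlgebra.ι_add_mul_swap w v), neg_mul, mul_assoc,
        pow_succ, mul_neg_one, neg_smul, smul_neg]
    | add x _ y _ hx hy => rw [add_mul, hx, hy, mul_add, smul_add]

lemma map_mem_adjoin_of_mem_pow {R V V' : Type*} [CommRing R] [AddCommGroup V] [Module R V]
    [AddCommGroup V'] [Module R V'] (f : V →ₗ[R] V') {P : Submodule R V} {W : Submodule R V'}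
    (hf : P ≤ W.comap f) (k : ℕ) {y : ExteriorAlgebra R V}
    (hy : y ∈ P.map (ExteriorAlgebra.ι R) ^ k) :
    ExteriorAlgebra.map f y ∈ Algebra.adjoin R ((W.map (ExteriorAlgebra.ι R) :
      Submodule R (ExteriorAlgebra R V')) : Set (ExteriorAlgebra R V')) := by
  induction k generalizing y with
  | zero =>
    rw [pow_zero, Submodule.mem_one] at hy
    obtain ⟨r, rfl⟩ := hy
    rw [AlgHom.commutes]
    exact Subalgebra.algebraMap_mem _ r
  | succ k ih =>
    rw [pow_succ'] at hy
    induction hy using Submodule.mul_induction_on' with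
    | mem_mul_mem m hm y hy =>
      obtain ⟨w, hw, rfl⟩ := hm
      rw [map_mul, ExteriorAlgebra.map_apply_ι]
      exact Subalgebra.mul_mem _ (Algebra.subset_adjoin ⟨_, hf hw, rfl⟩) (ih hy)
    | add x _ y _ hx hy => rw [map_add]; exact Subalgebra.add_mem _ hx hy

lemma map_mem_exteriorPower {R V V' : Type*} [CommRing R] [AddCommGroup V] [Module R V]
    [AddCommGroup V'] [Module R V'] (f : V →ₗ[R] V') (k : ℕ) {y : ExteriorAlgebra R V}
    (hy : y ∈ ⋀[R]^k V) : ExteriorAlgebra.map f y ∈ ⋀[R]^k V' := by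
  have h : ExteriorAlgebra.map f y ∈
      (⋀[R]^k V).map (ExteriorAlgebra.map f).toLinearMap := ⟨y, hy, rfl⟩
  rw [ExteriorAlgebra.exteriorPower, Submodule.map_pow] at h
  refine pow_le_pow_left' (?_ : _ ≤ LinearMap.range (ExteriorAlgebra.ι R)) k h
  rintro _ ⟨_, ⟨v, rfl⟩, rfl⟩
  exact ⟨f v, (ExteriorAlgebra.map_apply_ι f v).symm⟩

/-- If `⋀^(r+1) V = 0`, then `⋀^(2r) (V × V)` is the product of the two copies of `⋀^r V`. -/
lemma exteriorPower_prod_le {R V : Type*} [CommRing R] [AddCommGroup V] [Module R V] {r : ℕ}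
    (h : (⊤ : Submodule R V).map (ExteriorAlgebra.ι R) ^ (r + 1) = 0) :
    ⋀[R]^(r + r) (V × V) ≤
      ((⊤ : Submodule R V).map (ExteriorAlgebra.ι R) ^ r).map
        (ExteriorAlgebra.map (LinearMap.inl R V V)).toLinearMap *
      ((⊤ : Submodule R V).map (ExteriorAlgebra.ι R) ^ r).map
        (ExteriorAlgebra.map (LinearMap.inr R V V)).toLinearMap := by
  have hmap : ∀ f : V →ₗ[R] V × V,
      ((⊤ : Submodule R V).map (ExteriorAlgebra.ι R)).map (ExteriorAlgebra.map f).toLinearMap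
        = (LinearMap.range f).map (ExteriorAlgebra.ι R) := by
    intro f
    rw [← Submodule.map_top, ← Submodule.map_comp, ← Submodule.map_comp]
    congr 1
    ext v
    exact ExteriorAlgebra.map_apply_ι f v
  have hpow : ∀ f : V →ₗ[R] V × V,
      (LinearMap.range f).map (ExteriorAlgebra.ι R) ^ (r + 1) = 0 := by
    intro f
    rw [← hmap, ← Submodule.map_pow, h]
    exact Submodule.map_bot _
  rw [Submodule.map_pow, Submodule.map_pow, hmap, hmap, ExteriorAlgebra.exteriorPower]
  have htop : LinearMap.range (ExteriorAlgebra.ι R (M := V × V)) =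
      (LinearMap.range (LinearMap.inl R V V)).map (ExteriorAlgebra.ι R) ⊔
        (LinearMap.range (LinearMap.inr R V V)).map (ExteriorAlgebra.ι R) := by
    rw [← Submodule.map_sup, LinearMap.sup_range_inl_inr, Submodule.map_top]
  rw [htop]
  exact sup_pow_le_of_commute (commute_map_ι _ _) (hpow _) (hpow _)

/-- If `d θ = 1` and `⋀^(s+2) V = 0`, then `⋀^(s+1) V` is `θ` times `⋀^s (ker d)`. -/
lemma map_ι_top_pow_le {R V : Type*} [CommRing R] [AddCommGroup V] [Module R V]
    (d : Module.Dual R V) {θ : V} (hθ : d θ = 1) {s : ℕ}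
    (h : (⊤ : Submodule R V).map (ExteriorAlgebra.ι R) ^ (s + 2) = 0) :
    (⊤ : Submodule R V).map (ExteriorAlgebra.ι R) ^ (s + 1) ≤
      Submodule.span R {ExteriorAlgebra.ι R θ} *
        (LinearMap.ker d).map (ExteriorAlgebra.ι R) ^ s := by
  set P := (LinearMap.ker d).map (ExteriorAlgebra.ι R) with hP
  have hspan : (Submodule.span R {θ}).map (ExteriorAlgebra.ι R)
      = Submodule.span R {ExteriorAlgebra.ι R θ} := by
    rw [Submodule.map_span, Set.image_singleton]
  have hsq : Submodule.span R {ExteriorAlgebra.ι R θ} ^ (1 + 1) = 0 := by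
    rw [pow_succ, pow_one, Submodule.span_mul_span, Set.singleton_mul_singleton,
      ExteriorAlgebra.ι_sq_zero, Submodule.span_zero_singleton, Submodule.zero_eq_bot]
  have hPtop : P ≤ (⊤ : Submodule R V).map (ExteriorAlgebra.ι R) := Submodule.map_mono le_top
  have hPs : P ^ (s + 1) = 0 := by
    rw [Submodule.zero_eq_bot, eq_bot_iff]
    intro x hx
    have h0 : ExteriorAlgebra.ι R θ * x = 0 := by
      have : ExteriorAlgebra.ι R θ * x ∈
          (⊤ : Submodule R V).map (ExteriorAlgebra.ι R) ^ (s + 2) := by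
        rw [pow_succ']
        exact Submodule.mul_mem_mul ⟨θ, trivial, rfl⟩ (pow_le_pow_left' hPtop _ hx)
      rwa [h] at this
    have hdx : CliffordAlgebra.contractLeft d x = 0 := by
      have := map_mem_adjoin_of_mem_pow LinearMap.id (W := LinearMap.ker d) le_rfl _ hx
      rw [ExteriorAlgebra.map_id] at this
      exact contractLeft_eq_zero_of_mem_adjoin d le_rfl this
    have h1 := CliffordAlgebra.contractLeft_ι_mul d θ x
    rw [hdx, hθ, mul_zero, sub_zero, one_smul] at h1
    exact h1.symm.trans ((congrArg _ h0).trans (map_zero _))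
  have htop : (⊤ : Submodule R V).map (ExteriorAlgebra.ι R)
      = Submodule.span R {ExteriorAlgebra.ι R θ} ⊔ P := by
    rw [← hspan, hP, ← Submodule.map_sup]
    congr 1
    refine (eq_top_iff.2 fun v _ => ?_).symm
    rw [← add_sub_cancel (d v • θ) v]
    refine Submodule.add_mem_sup (Submodule.smul_mem _ _ (Submodule.mem_span_singleton_self θ)) ?_
    simp [hθ]
  have hcomm : Commute (Submodule.span R {ExteriorAlgebra.ι R θ}) P :=
    hspan ▸ commute_map_ι _ _
  rw [htop, add_comm s 1]
  exact (sup_pow_le_of_commute hcomm hsq hPs).trans (by rw [pow_one])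

lemma proj_exteriorPower_of_mem_same {R V : Type*} [CommRing R] [AddCommGroup V] [Module R V]
    {i : ℕ} {x : ExteriorAlgebra R V} (hx : x ∈ ⋀[R]^i V) :
    GradedAlgebra.proj (fun i : ℕ => ⋀[R]^i V) i x = x :=
  DirectSum.decompose_of_mem_same (fun i : ℕ => ⋀[R]^i V) hx

lemma proj_exteriorPower_of_mem_ne {R V : Type*} [CommRing R] [AddCommGroup V] [Module R V]
    {i j : ℕ} {x : ExteriorAlgebra R V} (hx : x ∈ ⋀[R]^i V) (hij : i ≠ j) :
    GradedAlgebra.proj (fun i : ℕ => ⋀[R]^i V) j x = 0 :=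
  DirectSum.decompose_of_mem_ne (fun i : ℕ => ⋀[R]^i V) hx hij

/-- `kappaVee n` lowers the degree by two. -/
lemma proj_kappaVee {N : Type} [AddCommGroup N] (n : N) (k : ℕ)
    (x : ExteriorAlgebra ℤ (Module.Dual ℤ N × Module.Dual ℤ N)) :
    GradedAlgebra.proj (fun i : ℕ => ⋀[ℤ]^i (Module.Dual ℤ N × Module.Dual ℤ N)) k
        (kappaVee n x) =
      kappaVee n (GradedAlgebra.proj
        (fun i : ℕ => ⋀[ℤ]^i (Module.Dual ℤ N × Module.Dual ℤ N)) (k + 2) x) := by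
  induction x using DirectSum.Decomposition.inductionOn
    (fun i : ℕ => ⋀[ℤ]^i (Module.Dual ℤ N × Module.Dual ℤ N)) with
  | zero => simp only [map_zero]
  | add x y hx hy => simp only [map_add, hx, hy]
  | @homogeneous i m =>
    obtain ⟨m, hm⟩ := m
    match i, hm with
    | 0, hm =>
      have h0 : kappaVee n m = 0 := by
        rw [kappaVee, LinearMap.comp_apply, contractLeft_eq_zero_of_mem_exteriorPower_zero _ hm,
          map_zero]
      rw [proj_exteriorPower_of_mem_ne hm (by omega), h0, map_zero, map_zero]
    | 1, hm =>
      have h0 : kappaVee n m = 0 :=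
        contractLeft_eq_zero_of_mem_exteriorPower_zero _ (contractLeft_mem_exteriorPower _ 0 hm)
      rw [proj_exteriorPower_of_mem_ne hm (by omega), h0, map_zero, map_zero]
    | i + 2, hm =>
      have hκ : kappaVee n m ∈ ⋀[ℤ]^i (Module.Dual ℤ N × Module.Dual ℤ N) :=
        contractLeft_mem_exteriorPower _ i (contractLeft_mem_exteriorPower _ (i + 1) hm)
      by_cases hik : i = k
      · subst hik
        rw [proj_exteriorPower_of_mem_same hm, proj_exteriorPower_of_mem_same hκ]
      · rw [proj_exteriorPower_of_mem_ne hm (by omega), map_zero,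
          proj_exteriorPower_of_mem_ne hκ hik]

lemma kappaVee_mul_of_mem_Cn {N : Type} [AddCommGroup N] (n : N)
    (a : ExteriorAlgebra ℤ (Module.Dual ℤ N × Module.Dual ℤ N))
    {b : ExteriorAlgebra ℤ (Module.Dual ℤ N × Module.Dual ℤ N)} (hb : b ∈ Cn n) :
    kappaVee n (a * b) = kappaVee n a * b := by
  simp only [kappaVee, LinearMap.comp_apply]
  rw [contractLeft_mul_of_eq_zero _ a (contractLeft_eq_zero_of_mem_adjoin _ ?_ hb),
    contractLeft_mul_of_eq_zero _ _ (contractLeft_eq_zero_of_mem_adjoin _ ?_ hb)]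
  · exact fun v hv => hv.2
  · exact fun v hv => hv.1

lemma kappaVee_mem_Cn {N : Type} [AddCommGroup N] {n n' : N} {c : ℤ}
    (hnc : n = c • n') {θ : Module.Dual ℤ N} (hθ : θ n' = 1)
    (x : ExteriorAlgebra ℤ (Module.Dual ℤ N × Module.Dual ℤ N)) : kappaVee n x ∈ Cn n := by
  have hx : x ∈ Algebra.adjoin ℤ (((⊤ : Submodule ℤ (Module.Dual ℤ N × Module.Dual ℤ N)).map
      (ExteriorAlgebra.ι ℤ) : Submodule ℤ (ExteriorAlgebra ℤ _)) : Set (ExteriorAlgebra ℤ _)) := by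
    induction x using CliffordAlgebra.left_induction with
    | algebraMap r => exact Subalgebra.algebraMap_mem _ r
    | add x y hx hy => exact Subalgebra.add_mem _ hx hy
    | ι_mul x m hx => exact Subalgebra.mul_mem _ (Algebra.subset_adjoin ⟨m, trivial, rfl⟩) hx
  have h1 := contractLeft_mem_adjoin_inf_ker ((Module.Dual.eval ℤ N n').comp
    (LinearMap.fst ℤ (Module.Dual ℤ N) (Module.Dual ℤ N))) (e := (θ, 0)) Submodule.mem_top hθ hx
  have h2 := contractLeft_mem_adjoin_inf_ker ((Module.Dual.eval ℤ N n').comp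
    (LinearMap.snd ℤ (Module.Dual ℤ N) (Module.Dual ℤ N))) (e := (0, θ))
    (Submodule.mem_inf.2 ⟨Submodule.mem_top, LinearMap.mem_ker.2 (by simp)⟩) hθ h1
  have hfst : (Module.Dual.eval ℤ N n).comp
      (LinearMap.fst ℤ (Module.Dual ℤ N) (Module.Dual ℤ N)) =
      c • (Module.Dual.eval ℤ N n').comp
        (LinearMap.fst ℤ (Module.Dual ℤ N) (Module.Dual ℤ N)) := by
    rw [hnc, map_smul, LinearMap.smul_comp]
  have hsnd : (Module.Dual.eval ℤ N n).comp
      (LinearMap.snd ℤ (Module.Dual ℤ N) (Module.Dual ℤ N)) =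
      c • (Module.Dual.eval ℤ N n').comp
        (LinearMap.snd ℤ (Module.Dual ℤ N) (Module.Dual ℤ N)) := by
    rw [hnc, map_smul, LinearMap.smul_comp]
  rw [kappaVee, LinearMap.comp_apply, hfst, hsnd]
  simp only [map_smul, LinearMap.smul_apply]
  refine Submodule.smul_mem _ _ (Submodule.smul_mem _ _ ?_)
  refine Algebra.adjoin_mono (Submodule.map_mono ?_) h2
  rintro ⟨v, w⟩ ⟨⟨-, hv⟩, hw⟩
  replace hv : v n' = 0 := hv
  replace hw : w n' = 0 := hw
  refine ⟨?_, ?_⟩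
  · change v n = 0
    rw [hnc, map_smul, hv, smul_zero]
  · change w n = 0
    rw [hnc, map_smul, hw, smul_zero]

/-- The square of `θ ∧ α` is the square of `θ` times the square of `α`. -/
lemma extSq_ι_mul {V : Type} [AddCommGroup V] (θ : V) (s : ℕ) {α : ExteriorAlgebra ℤ V}
    (hα : α ∈ ⋀[ℤ]^s V) :
    extSq (s + 1) (ExteriorAlgebra.ι ℤ θ * α) =
      ExteriorAlgebra.ι ℤ (θ, 0) * (ExteriorAlgebra.ι ℤ (0, θ) * extSq s α) := by
  have hsign : (-1 : ℤ) ^ ((s + 1) * (s + 1 - 1) / 2) * (-1) ^ s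
      = (-1 : ℤ) ^ (s * (s - 1) / 2) := by
    have : (s + 1) * (s + 1 - 1) / 2 = s * (s - 1) / 2 + s := by
      rw [← Finset.sum_range_id, ← Finset.sum_range_id, Finset.sum_range_succ]
    rw [this, pow_add, mul_assoc, ← mul_pow, neg_one_mul, neg_neg, one_pow, mul_one]
  have hswap := mul_ι_of_mem_exteriorPower ((0, θ) : V × V) s
    (map_mem_exteriorPower (LinearMap.inl ℤ V V) s hα)
  rw [extSq, extSq, map_mul, map_mul, ExteriorAlgebra.map_apply_ι, ExteriorAlgebra.map_apply_ι,
    LinearMap.inl_apply, LinearMap.inr_apply, mul_assoc, ← mul_assoc _ (ExteriorAlgebra.ι ℤ (0, θ)),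
    hswap, ← hsign, smul_mul_assoc, mul_smul_comm, smul_smul, mul_smul_comm, mul_smul_comm,
    mul_assoc]

lemma kappaVee_ι_mul_ι_mul {N : Type} [AddCommGroup N] (n : N) (θ : Module.Dual ℤ N)
    {b : ExteriorAlgebra ℤ (Module.Dual ℤ N × Module.Dual ℤ N)} (hb : b ∈ Cn n) :
    kappaVee n (ExteriorAlgebra.ι ℤ (θ, 0) * (ExteriorAlgebra.ι ℤ (0, θ) * b)) =
      (θ n) ^ 2 • b := by
  rw [← mul_assoc, kappaVee_mul_of_mem_Cn n _ hb, kappaVee, LinearMap.comp_apply]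
  have h1 := CliffordAlgebra.contractLeft_ι_mul (Q := (0 : QuadraticForm ℤ _))
    ((Module.Dual.eval ℤ N n).comp (LinearMap.fst ℤ (Module.Dual ℤ N) (Module.Dual ℤ N)))
    (θ, 0) (ExteriorAlgebra.ι ℤ (0, θ))
  have h2 := CliffordAlgebra.contractLeft_ι (Q := (0 : QuadraticForm ℤ _))
    ((Module.Dual.eval ℤ N n).comp (LinearMap.fst ℤ (Module.Dual ℤ N) (Module.Dual ℤ N)))
    (0, θ)
  have h3 := CliffordAlgebra.contractLeft_ι (Q := (0 : QuadraticForm ℤ _))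
    ((Module.Dual.eval ℤ N n).comp (LinearMap.snd ℤ (Module.Dual ℤ N) (Module.Dual ℤ N)))
    (0, θ)
  have h4 : CliffordAlgebra.contractLeft (Q := (0 : QuadraticForm ℤ _))
    ((Module.Dual.eval ℤ N n).comp (LinearMap.fst ℤ (Module.Dual ℤ N) (Module.Dual ℤ N)))
    (ExteriorAlgebra.ι ℤ (θ, 0) * ExteriorAlgebra.ι ℤ (0, θ))
      = θ n • ExteriorAlgebra.ι ℤ (0, θ) := by
    refine h1.trans ?_
    rw [show CliffordAlgebra.contractLeft (Q := (0 : QuadraticForm ℤ _))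
      ((Module.Dual.eval ℤ N n).comp (LinearMap.fst ℤ (Module.Dual ℤ N) (Module.Dual ℤ N))) (ExteriorAlgebra.ι ℤ (0, θ)) = 0 from
      h2.trans (map_zero _), mul_zero, sub_zero]
    rfl
  rw [h4, map_smul, show CliffordAlgebra.contractLeft (Q := (0 : QuadraticForm ℤ _))
    ((Module.Dual.eval ℤ N n).comp
      (LinearMap.snd ℤ (Module.Dual ℤ N) (Module.Dual ℤ N))) (ExteriorAlgebra.ι ℤ (0, θ)) =
      algebraMap ℤ _ (θ n) from h3, smul_mul_assoc, ← Algebra.smul_def, smul_smul, pow_two]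

lemma extSq_smul {V : Type} [AddCommGroup V] (k : ℕ) (u : ℤ) (x : ExteriorAlgebra ℤ V) :
    extSq k (u • x) = u ^ 2 • extSq k x := by
  rw [extSq, extSq, map_smul, map_smul, smul_mul_smul_comm, smul_comm, pow_two]

lemma extSq_mem_Cn {N : Type} [AddCommGroup N] (n : N) (s : ℕ)
    {α : ExteriorAlgebra ℤ (Module.Dual ℤ N)}
    (hα : α ∈ (LinearMap.ker (Module.Dual.eval ℤ N n)).map (ExteriorAlgebra.ι ℤ) ^ s) :
    extSq s α ∈ Cn n := by
  have hl := map_mem_adjoin_of_mem_pow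
    (LinearMap.inl ℤ (Module.Dual ℤ N) (Module.Dual ℤ N))
    (W := (LinearMap.ker (Module.Dual.eval ℤ N n)).prod (LinearMap.ker (Module.Dual.eval ℤ N n)))
    (fun _ hw => Submodule.mem_prod.2 ⟨hw, Submodule.zero_mem _⟩) s hα
  have hr := map_mem_adjoin_of_mem_pow
    (LinearMap.inr ℤ (Module.Dual ℤ N) (Module.Dual ℤ N))
    (W := (LinearMap.ker (Module.Dual.eval ℤ N n)).prod (LinearMap.ker (Module.Dual.eval ℤ N n)))
    (fun _ hw => Submodule.mem_prod.2 ⟨Submodule.zero_mem _, hw⟩) s hα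
  rw [extSq]
  exact Submodule.smul_mem _ _ (Subalgebra.mul_mem _ hl hr)

/-- **Adjointness of `κ_n` and `κ_n^∨`** (equation (TrKappa), the key verification for the
multiplicity TrQFT `F_Mult`).  Let `n = c • n′ ∈ N` be nonzero of index `c = |n|`, with `n′`
primitive.  With `𝒞_0 = Λ^*(M⊕M)`, `𝒞_n = Λ^*(M_n⊕M_n)`, `κ_n : 𝒞_n → 𝒞_0` equal to `|n|²`
times the inclusion, `κ_n^∨ = ι_{(0,n)}∘ι_{(n,0)} : 𝒞_0 → 𝒞_n`, and `Tr_0`, `Tr_n` the traces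
determined by the squared generators `Θ_0^□`, `Θ_n^□` of the top exterior powers:
for all `a ∈ 𝒞_0` and `b ∈ 𝒞_n`, `Tr_n(κ_n^∨(a) ∧ b) = Tr_0(a ∧ κ_n(b))`. -/
theorem trKappa_adjoint (N : Type) [AddCommGroup N] [Module.Free ℤ N] [Module.Finite ℤ N]
    (r : ℕ) (hr : r = finrank ℤ N)
    (n n' : N) (c : ℕ) (hc : 0 < c) (hn' : IsPrimitiveElt n') (hnc : n = (c : ℤ) • n')
    (Θ₀ : ExteriorAlgebra ℤ (Module.Dual ℤ N))
    (hΘ₀ : Submodule.span ℤ {Θ₀} = extSubPow (⊤ : Submodule ℤ (Module.Dual ℤ N)) r)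
    (Θn : ExteriorAlgebra ℤ (Module.Dual ℤ N))
    (hΘn : Submodule.span ℤ {Θn} = extSubPow (LinearMap.ker (Module.Dual.eval ℤ N n)) (r - 1))
    (Tr₀ : ExteriorAlgebra ℤ (Module.Dual ℤ N × Module.Dual ℤ N) →ₗ[ℤ] ℤ)
    (hTr₀ : ∀ (x : ExteriorAlgebra ℤ (Module.Dual ℤ N × Module.Dual ℤ N)) (z : ℤ),
      GradedAlgebra.proj (fun i : ℕ => ⋀[ℤ]^i (Module.Dual ℤ N × Module.Dual ℤ N)) (2 * r) x
        = z • extSq r Θ₀ → Tr₀ x = z)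
    (Trn : ExteriorAlgebra ℤ (Module.Dual ℤ N × Module.Dual ℤ N) →ₗ[ℤ] ℤ)
    (hTrn : ∀ x ∈ Cn n, ∀ z : ℤ,
      GradedAlgebra.proj (fun i : ℕ => ⋀[ℤ]^i (Module.Dual ℤ N × Module.Dual ℤ N)) (2 * r - 2) x
        = z • extSq (r - 1) Θn → Trn x = z) :
    ∀ a : ExteriorAlgebra ℤ (Module.Dual ℤ N × Module.Dual ℤ N), ∀ b ∈ Cn n,
      Trn (kappaVee n a * b) = Tr₀ (a * ((c : ℤ) ^ 2 • b)) := by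
  obtain ⟨θ, hθ⟩ := hn'.exists_dual_eq_one
  have hc0 : (c : ℤ) ≠ 0 := by exact_mod_cast hc.ne'
  obtain ⟨s, rfl⟩ : ∃ s, r = s + 1 := by
    refine Nat.exists_eq_succ_of_ne_zero fun h => ?_
    have : Subsingleton N := (Module.finrank_eq_zero_iff_of_free ℤ N).1 (by rw [← hr, h])
    rw [Subsingleton.elim n' 0, map_zero] at hθ
    exact zero_ne_one hθ
  have hrank : finrank ℤ (Module.Dual ℤ N) = s + 1 := by
    rw [hr]
    exact (Module.Free.chooseBasis ℤ N).toDualEquiv.finrank_eq.symm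
  have hpow : (⊤ : Submodule ℤ (Module.Dual ℤ N)).map (ExteriorAlgebra.ι ℤ) ^ (s + 2) = 0 :=
    map_ι_top_pow_eq_zero (by omega)
  have hker : LinearMap.ker (Module.Dual.eval ℤ N n) = LinearMap.ker (Module.Dual.eval ℤ N n') := by
    ext w
    change w n = 0 ↔ w n' = 0
    rw [hnc, map_smul, smul_eq_zero_iff_right hc0]
  rw [Nat.add_sub_cancel] at hΘn hTrn
  rw [extSubPow] at hΘ₀ hΘn
  have hΘn_mem := hΘn ▸ Submodule.mem_span_singleton_self Θn
  have hΘn_deg : Θn ∈ ⋀[ℤ]^s (Module.Dual ℤ N) := by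
    rw [ExteriorAlgebra.exteriorPower, ← Submodule.map_top]
    exact pow_le_pow_left' (Submodule.map_mono le_top) s hΘn_mem
  obtain ⟨u, hu⟩ : ∃ u : ℤ, u • (ExteriorAlgebra.ι ℤ θ * Θn) = Θ₀ := by
    have h := map_ι_top_pow_le (Module.Dual.eval ℤ N n') hθ hpow
    rw [← hΘ₀, ← hker, ← hΘn, Submodule.span_mul_span, Set.singleton_mul_singleton] at h
    exact Submodule.mem_span_singleton.1 (h (Submodule.mem_span_singleton_self Θ₀))
  obtain ⟨v, hv⟩ : ∃ v : ℤ, v • Θ₀ = ExteriorAlgebra.ι ℤ θ * Θn := by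
    rw [← Submodule.mem_span_singleton, hΘ₀, pow_succ', Submodule.map_top]
    exact Submodule.mul_mem_mul ⟨θ, rfl⟩ hΘn_deg
  have huv : u * v = 1 := by
    have h : (u * v - 1) • Θ₀ = 0 := by rw [sub_smul, mul_smul, hv, hu, one_smul, sub_self]
    have h2 : (u * v - 1) • extSq (s + 1) Θ₀ = 0 := by
      rw [extSq, smul_comm, ← smul_mul_assoc, ← map_smul, h, map_zero, zero_mul, smul_zero]
    have h3 := hTr₀ 0 (u * v - 1) (by rw [h2, map_zero])
    rw [map_zero] at h3
    omega
  have hu2 : u ^ 2 = 1 := by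
    rcases Int.eq_one_or_neg_one_of_mul_eq_one huv with h | h <;> rw [h] <;> norm_num
  have hextSq_mem : extSq s Θn ∈ Cn n :=
    extSq_mem_Cn n s hΘn_mem
  have hθn : θ n = c := by rw [hnc, map_smul, hθ, smul_eq_mul, mul_one]
  have hκ : kappaVee n (extSq (s + 1) Θ₀) = (c : ℤ) ^ 2 • extSq s Θn := by
    rw [← hu, extSq_smul, hu2, one_smul, extSq_ι_mul θ s hΘn_deg,
      kappaVee_ι_mul_ι_mul n θ hextSq_mem, hθn]
  intro a b hb
  obtain ⟨z, hz⟩ : ∃ z : ℤ, z • extSq (s + 1) Θ₀ =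
      GradedAlgebra.proj (fun i : ℕ => ⋀[ℤ]^i (Module.Dual ℤ N × Module.Dual ℤ N))
        (2 * (s + 1)) (a * b) := by
    have hmem : GradedAlgebra.proj (fun i : ℕ => ⋀[ℤ]^i (Module.Dual ℤ N × Module.Dual ℤ N))
        (2 * (s + 1)) (a * b) ∈ ⋀[ℤ]^(2 * (s + 1)) (Module.Dual ℤ N × Module.Dual ℤ N) :=
      SetLike.coe_mem _
    rw [two_mul] at hmem ⊢
    have h := exteriorPower_prod_le hpow hmem
    rw [← hΘ₀, Submodule.map_span, Submodule.map_span, Set.image_singleton, Set.image_singleton,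
      Submodule.span_mul_span, Set.singleton_mul_singleton, Submodule.mem_span_singleton] at h
    obtain ⟨z, hz⟩ := h
    refine ⟨z * (-1) ^ ((s + 1) * (s + 1 - 1) / 2), ?_⟩
    rw [← hz, extSq, smul_smul, mul_assoc, ← mul_pow, neg_one_mul, neg_neg, one_pow, mul_one]
    rfl
  rw [← kappaVee_mul_of_mem_Cn n a hb, mul_smul_comm, map_smul, hTr₀ (a * b) z hz.symm]
  refine hTrn _ (kappaVee_mem_Cn hnc hθ _) _ ?_
  rw [show 2 * (s + 1) - 2 = 2 * s by omega, proj_kappaVee,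
    show 2 * s + 2 = 2 * (s + 1) by ring, ← hz, map_smul, hκ, smul_smul, smul_eq_mul, mul_comm z]
end
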